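/- arXiv:1402.5021 — 2 statements merged into one kernel-verified Lean document; each statement's English description precedes it below -/
import Mathlib

section
/- Let z_1, …, z_n and c_1, …, c_n be complex numbers with c_j ≠ z_k for all j, k. Then det((c_j − z_k)^{−2})_{j,k} = det((c_j − z_k)^{−1})_{j,k} · per((c_j − z_k)^{−1})_{j,k}, where per denotes the permanent. -/
section FirstRowCofactor

open Equiv Finset

variable {K : Type*} [Field K] {n : ℕ}

/-- The coefficient of the entry `(0, k)` of `A` in `∑ σ, ε σ * ∏ i, A i (σ i)`. -/
def firstRowCofactor (ε : Perm (Fin (n + 1)) → K)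
    (A : Matrix (Fin (n + 1)) (Fin (n + 1)) K) (k : Fin (n + 1)) : K :=
  ∑ σ : Perm (Fin (n + 1)), if σ 0 = k then ε σ * ∏ i : Fin n, A i.succ (σ i.succ) else 0

theorem sum_perm_eq_sum_mul_firstRowCofactor (ε : Perm (Fin (n + 1)) → K)
    (A : Matrix (Fin (n + 1)) (Fin (n + 1)) K) :
    ∑ σ : Perm (Fin (n + 1)), ε σ * ∏ i, A i (σ i) = ∑ k, A 0 k * firstRowCofactor ε A k := by
  simp_rw [firstRowCofactor, mul_sum]
  rw [sum_comm]
  refine sum_congr rfl fun σ _ => ?_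
  simp [Fin.prod_univ_succ]
  ring

theorem det_eq_sum_mul_firstRowCofactor (A : Matrix (Fin (n + 1)) (Fin (n + 1)) K) :
    A.det = ∑ k, A 0 k * firstRowCofactor (fun σ => ((Perm.sign σ : ℤ) : K)) A k := by
  rw [← sum_perm_eq_sum_mul_firstRowCofactor, ← Matrix.det_transpose, Matrix.det_apply']
  rfl

theorem permanent_eq_sum_mul_firstRowCofactor (A : Matrix (Fin (n + 1)) (Fin (n + 1)) K) :
    A.permanent = ∑ k, A 0 k * firstRowCofactor (fun _ => 1) A k := by
  rw [← sum_perm_eq_sum_mul_firstRowCofactor, ← Matrix.permanent_transpose]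
  simp [Matrix.permanent]

theorem firstRowCofactor_eq_sum_decomposeFin (ε : Perm (Fin (n + 1)) → K)
    (A : Matrix (Fin (n + 1)) (Fin (n + 1)) K) (k : Fin (n + 1)) :
    firstRowCofactor ε A k = ∑ e : Perm (Fin n), ε (Perm.decomposeFin.symm (k, e)) *
      ∏ i : Fin n, A i.succ (swap 0 k (e i).succ) := by
  rw [firstRowCofactor, ← Equiv.sum_comp Perm.decomposeFin.symm, Fintype.sum_prod_type,
    sum_eq_single k]
  · simp
  · intro b _ hb
    simp [hb]
  · simp

theorem firstRowCofactor_sign (A : Matrix (Fin (n + 1)) (Fin (n + 1)) K) (k : Fin (n + 1)) :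
    firstRowCofactor (fun σ => ((Perm.sign σ : ℤ) : K)) A k =
      (if k = 0 then 1 else -1) * (A.submatrix Fin.succ fun j => swap 0 k j.succ).det := by
  rw [firstRowCofactor_eq_sum_decomposeFin, ← Matrix.det_transpose, Matrix.det_apply', mul_sum]
  refine sum_congr rfl fun e _ => ?_
  rw [Equiv.Perm.decomposeFin.symm_sign]
  split_ifs <;> simp

theorem firstRowCofactor_one (A : Matrix (Fin (n + 1)) (Fin (n + 1)) K) (k : Fin (n + 1)) :
    firstRowCofactor (fun _ => 1) A k =
      (A.submatrix Fin.succ fun j => swap 0 k j.succ).permanent := by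
  rw [firstRowCofactor_eq_sum_decomposeFin, ← Matrix.permanent_transpose]
  simp [Matrix.permanent]

theorem sum_firstRowCofactor_mul_inv_sub (ε : Perm (Fin (n + 1)) → K) (u : K)
    (hε : ∀ (σ : Perm (Fin (n + 1))) (i j : Fin (n + 1)), i ≠ j → ε (σ * swap i j) = u * ε σ)
    (z c : Fin (n + 1) → K) (h : ∀ j k, c j ≠ z k) (hz : Function.Injective z)
    (k : Fin (n + 1)) :
    ∑ l, firstRowCofactor ε (Matrix.of fun j k => (c j - z k)⁻¹) l * (z k - z l)⁻¹ =
      u * firstRowCofactor ε (Matrix.of fun j k => (c j - z k)⁻¹) k *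
        (∑ l, (z k - z l)⁻¹ + ∑ i : Fin n, (c i.succ - z k)⁻¹) := by
  set F : Perm (Fin (n + 1)) → K :=
    fun σ => ε σ * ∏ i : Fin n, (c i.succ - z (σ i.succ))⁻¹ with hF
  have swap_term (τ : Perm (Fin (n + 1))) (hτ : τ 0 = k) (i : Fin n) :
      F (τ * swap 0 i.succ) * (z k - z (τ i.succ))⁻¹ =
        u * F τ * ((z k - z (τ i.succ))⁻¹ + (c i.succ - z k)⁻¹) := by
    have hne : z k - z (τ i.succ) ≠ 0 := by
      rw [sub_ne_zero, ← hτ]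
      exact fun e => (Fin.succ_ne_zero i) (τ.injective (hz e)).symm
    have h1 : c i.succ - z k ≠ 0 := sub_ne_zero.2 (h _ _)
    have h2 : c i.succ - z (τ i.succ) ≠ 0 := sub_ne_zero.2 (h _ _)
    have hrest : ∏ j ∈ univ.erase i, (c j.succ - z ((τ * swap 0 i.succ) j.succ))⁻¹ =
        ∏ j ∈ univ.erase i, (c j.succ - z (τ j.succ))⁻¹ := by
      refine prod_congr rfl fun j hj => ?_
      rw [Perm.mul_apply, swap_apply_of_ne_of_ne (Fin.succ_ne_zero j)
        (fun e => (mem_erase.1 hj).1 (Fin.succ_injective _ e))]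
    simp only [hF]
    rw [hε τ 0 i.succ (Fin.succ_ne_zero i).symm, ← mul_prod_erase univ _ (mem_univ i),
      ← mul_prod_erase univ (fun j : Fin n => (c j.succ - z (τ j.succ))⁻¹) (mem_univ i), hrest,
      Perm.mul_apply, swap_apply_right, hτ]
    field_simp
    ring
  have sum_by_preimage (G : Perm (Fin (n + 1)) → K) :
      ∑ σ, G σ = ∑ i, ∑ σ : Perm (Fin (n + 1)), if σ i = k then G σ else 0 := by
    rw [sum_comm]
    refine sum_congr rfl fun σ _ => ?_
    simp_rw [← Equiv.eq_symm_apply σ]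
    simp
  have lhs_eq : ∑ l, firstRowCofactor ε (Matrix.of fun j k => (c j - z k)⁻¹) l * (z k - z l)⁻¹ =
      ∑ σ, F σ * (z k - z (σ 0))⁻¹ := by
    simp_rw [firstRowCofactor, sum_mul]
    rw [sum_comm]
    refine sum_congr rfl fun σ _ => ?_
    simp [hF, ite_mul]
  have first_zero : (∑ σ : Perm (Fin (n + 1)),
      if σ 0 = k then F σ * (z k - z (σ 0))⁻¹ else 0) = 0 := by
    refine sum_eq_zero fun σ _ => ?_
    split_ifs with hσ
    · simp [hσ]
    · rfl
  rw [lhs_eq, sum_by_preimage, Fin.sum_univ_succ, first_zero, zero_add]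
  have reindex (i : Fin n) : (∑ σ : Perm (Fin (n + 1)),
      if σ i.succ = k then F σ * (z k - z (σ 0))⁻¹ else 0) = ∑ τ : Perm (Fin (n + 1)),
      if τ 0 = k then u * F τ * ((z k - z (τ i.succ))⁻¹ + (c i.succ - z k)⁻¹) else 0 := by
    rw [← Equiv.sum_comp (Equiv.mulRight (swap 0 i.succ))]
    refine sum_congr rfl fun τ _ => ?_
    simp only [Equiv.coe_mulRight, Perm.mul_apply, swap_apply_right, swap_apply_left]
    split_ifs with hτ
    · exact swap_term τ hτ i
    · rfl
  simp_rw [reindex]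
  rw [sum_comm, firstRowCofactor, mul_sum, sum_mul]
  refine sum_congr rfl fun τ _ => ?_
  split_ifs with hτ
  · rw [← mul_sum, sum_add_distrib, ← Equiv.sum_comp τ (fun l => (z k - z l)⁻¹),
      Fin.sum_univ_succ (fun i => (z k - z (τ i))⁻¹), hτ]
    simp [hF]
  · simp

end FirstRowCofactor

/-- Borchardt's determinant identity over a field. -/
theorem det_inv_sq_eq_det_inv_mul_permanent_inv {K : Type*} [Field K] (n : ℕ) (z c : Fin n → K)
    (h : ∀ j k, c j ≠ z k) :
    Matrix.det (Matrix.of fun j k => ((c j - z k) ^ 2)⁻¹)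
      = Matrix.det (Matrix.of fun j k => (c j - z k)⁻¹)
        * Matrix.permanent (Matrix.of fun j k => (c j - z k)⁻¹) := by
  by_cases hz : Function.Injective z
  swap
  · obtain ⟨k, l, hkl, hne⟩ : ∃ k l, z k = z l ∧ k ≠ l := by
      simpa [Function.Injective] using hz
    rw [Matrix.det_zero_of_column_eq hne (by simp [hkl]),
      Matrix.det_zero_of_column_eq hne (by simp [hkl]), zero_mul]
  induction n with
  | zero => simp [Matrix.permanent]
  | succ n ih =>
    have cofactor_sq (k : Fin (n + 1)) :
        firstRowCofactor (fun σ => ((Equiv.Perm.sign σ : ℤ) : K))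
            (Matrix.of fun j k => ((c j - z k) ^ 2)⁻¹) k =
          firstRowCofactor (fun σ => ((Equiv.Perm.sign σ : ℤ) : K))
            (Matrix.of fun j k => (c j - z k)⁻¹) k *
          firstRowCofactor (fun _ => 1) (Matrix.of fun j k => (c j - z k)⁻¹) k := by
      rw [firstRowCofactor_sign, firstRowCofactor_sign, firstRowCofactor_one, mul_assoc]
      congr 1
      exact ih (fun j => z (Equiv.swap 0 k j.succ)) (fun j => c j.succ) (fun _ _ => h _ _)
        (hz.comp ((Equiv.injective _).comp (Fin.succ_injective n)))
    rw [det_eq_sum_mul_firstRowCofactor, det_eq_sum_mul_firstRowCofactor,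
      permanent_eq_sum_mul_firstRowCofactor]
    simp_rw [cofactor_sq]
    have det_rel := sum_firstRowCofactor_mul_inv_sub
      (fun σ => ((Equiv.Perm.sign σ : ℤ) : K)) (-1)
      (fun σ i j hij => by simp [Equiv.Perm.sign_swap hij]) z c h hz
    have per_rel := sum_firstRowCofactor_mul_inv_sub (fun _ => (1 : K)) 1
      (fun σ i j hij => by simp) z c h hz
    generalize firstRowCofactor (fun σ => ((Equiv.Perm.sign σ : ℤ) : K))
      (Matrix.of fun j k => (c j - z k)⁻¹) = D at *
    generalize firstRowCofactor (fun _ => (1 : K))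
      (Matrix.of fun j k => (c j - z k)⁻¹) = P at *
    simp only [Matrix.of_apply]
    have partial_fractions (k l : Fin (n + 1)) :
        (c 0 - z k)⁻¹ * D k * ((c 0 - z l)⁻¹ * P l) =
          (if k = l then ((c 0 - z k) ^ 2)⁻¹ * (D k * P k) else 0) +
          ((c 0 - z k)⁻¹ * D k * (P l * (z k - z l)⁻¹) +
            (c 0 - z l)⁻¹ * P l * (D k * (z l - z k)⁻¹)) := by
      have hk : c 0 - z k ≠ 0 := sub_ne_zero.2 (h _ _)
      have hl : c 0 - z l ≠ 0 := sub_ne_zero.2 (h _ _)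
      split_ifs with hkl
      · subst hkl
        simp
        field_simp
      · have hne : z k - z l ≠ 0 := sub_ne_zero.2 (hz.ne hkl)
        rw [← neg_sub (z k) (z l), inv_neg]
        field_simp
        ring
    rw [Finset.sum_mul_sum]
    simp_rw [partial_fractions, Finset.sum_add_distrib]
    rw [Finset.sum_comm (f := fun k l => (c 0 - z l)⁻¹ * P l * (D k * (z l - z k)⁻¹))]
    simp_rw [← Finset.mul_sum, det_rel, per_rel]
    rw [← Finset.sum_add_distrib, Finset.sum_eq_zero (s := Finset.univ)
      (f := fun k => (c 0 - z k)⁻¹ * D k * _ + _) (fun k _ => by ring)]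
    simp

theorem stmt9 (n : ℕ) (z c : Fin n → ℂ) (h : ∀ j k, c j ≠ z k) :
    Matrix.det (Matrix.of fun j k => ((c j - z k) ^ 2)⁻¹)
      = Matrix.det (Matrix.of fun j k => (c j - z k)⁻¹)
        * Matrix.permanent (Matrix.of fun j k => (c j - z k)⁻¹) := by
  exact det_inv_sq_eq_det_inv_mul_permanent_inv n z c h
end

section
/- Let n ≥ 4 and a > √2·(3√n)^{1/n}, and let P_n(x) = (x − a)·p(x) where p is a real polynomial of degree n − 1 with no roots in [−1, 1]. Then max_{x ∈ [−1,1]} √(1 − x²)·|P_n'(x)| ≥ n·min_{x ∈ [−1,1]} |P_n(x)| / √(T_n(a)² − 1). -/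
noncomputable def chebT (n : ℤ) (x : ℝ) : ℝ := (Polynomial.Chebyshev.T ℝ n).eval x
noncomputable def chebU (n : ℤ) (x : ℝ) : ℝ := (Polynomial.Chebyshev.U ℝ n).eval x

open Polynomial

/-- At a zero of `T_n` we have `|sin (n θ)| = 1`, expressed through `U_{n-1}`. -/
lemma sqrt_one_sub_sq_mul_abs_eval_U_of_eval_T_eq_zero {n : ℕ} (hn : n ≠ 0) {x : ℝ}
    (hx : (Chebyshev.T ℝ n).eval x = 0) :
    x ∈ Set.Icc (-1 : ℝ) 1 ∧
      Real.sqrt (1 - x ^ 2) * |(Chebyshev.U ℝ ((n : ℤ) - 1)).eval x| = 1 := by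
  have hx1 : |x| ≤ 1 := by
    rw [Chebyshev.abs_eval_T_real_le_one_iff (n := n) (by exact_mod_cast hn), hx]
    simp
  obtain ⟨hl, hu⟩ := abs_le.mp hx1
  refine ⟨⟨hl, hu⟩, ?_⟩
  have hT := Chebyshev.T_real_cos (Real.arccos x) n
  have hU := Chebyshev.U_real_cos (Real.arccos x) ((n : ℤ) - 1)
  rw [Real.cos_arccos hl hu] at hT hU
  rw [Real.sin_arccos] at hU
  have h_pyth := Real.sin_sq_add_cos_sq ((n : ℤ) * Real.arccos x)
  push_cast at hT hU h_pyth
  rw [sub_add_cancel] at hU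
  rw [← hT, ← hU, hx] at h_pyth
  rw [← abs_of_nonneg (Real.sqrt_nonneg (1 - x ^ 2)), ← abs_mul, mul_comm, ← sq_eq_sq₀
    (abs_nonneg _) zero_le_one, sq_abs]
  linarith

/-- Lagrange interpolation at the zeros of `T_n`. -/
lemma eval_eq_sum_roots_T {n : ℕ} (hn : n ≠ 0) {f : ℝ[X]} (hf : f.degree < n) {x : ℝ}
    (hx : 1 < x) :
    f.eval x = ∑ i ∈ (Chebyshev.T ℝ n).roots.toFinset,
      f.eval i / (Chebyshev.U ℝ ((n : ℤ) - 1)).eval i *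
        ((Chebyshev.T ℝ n).eval x / (n * (x - i))) := by
  set s := (Chebyshev.T ℝ n).roots.toFinset with hs
  have h_root : ∀ i ∈ s, (Chebyshev.T ℝ n).eval i = 0 := fun i hi => by
    simpa [hs, Chebyshev.T_ne_zero] using hi
  have h_nodup : (Chebyshev.T ℝ n).roots.Nodup := by
    rw [Chebyshev.roots_T_real]
    exact Finset.nodup _
  have hs_val : s.val = (Chebyshev.T ℝ n).roots := by
    rw [hs, Multiset.toFinset_val, h_nodup.dedup]
  have h_card : s.card = n := by
    rw [Finset.card_def, hs_val, Chebyshev.roots_T_real, ← Finset.card_def,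
      Finset.card_image_of_injOn, Finset.card_range]
    exact (Finset.range n).nodup_map_iff_injOn.mp (Chebyshev.roots_T_real_nodup n)
  have h_fac : Chebyshev.T ℝ n =
      C (Chebyshev.T ℝ n).leadingCoeff * Lagrange.nodal s id := by
    conv_lhs => rw [← C_leadingCoeff_mul_prod_multiset_X_sub_C (p := Chebyshev.T ℝ n)
      (by rw [← hs_val, ← Finset.card_def, h_card, Chebyshev.natDegree_T, Int.natAbs_natCast])]
    rw [Lagrange.nodal_eq, Finset.prod, hs_val]
    rfl
  set c := (Chebyshev.T ℝ n).leadingCoeff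
  have hc : c ≠ 0 := leadingCoeff_ne_zero.mpr (Chebyshev.T_ne_zero ℝ n)
  have h_ne : ∀ i ∈ s, x ≠ id i := fun i hi h => by
    have := (sqrt_one_sub_sq_mul_abs_eval_U_of_eval_T_eq_zero hn (h_root i hi)).1.2
    simp only [id] at h
    linarith
  conv_lhs => rw [Lagrange.eq_interpolate (s := s) (v := id) (f := f) Function.injective_id.injOn
    (by rwa [h_card]), Lagrange.eval_interpolate_not_at_node _ h_ne]
  rw [Finset.mul_sum]
  refine Finset.sum_congr rfl fun i hi => ?_
  have h_deriv : c * (derivative (Lagrange.nodal s id)).eval i =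
      n * (Chebyshev.U ℝ ((n : ℤ) - 1)).eval i := by
    have := congrArg (fun q => (derivative q).eval i) h_fac
    simpa [Chebyshev.T_derivative_eq_U] using this.symm
  have hU : (Chebyshev.U ℝ ((n : ℤ) - 1)).eval i ≠ 0 := fun h => by
    simpa [h] using (sqrt_one_sub_sq_mul_abs_eval_U_of_eval_T_eq_zero hn (h_root i hi)).2
  have hn' : (n : ℝ) ≠ 0 := by exact_mod_cast hn
  have hN : (derivative (Lagrange.nodal s id)).eval i ≠ 0 := fun h => by
    rw [h, mul_zero] at h_deriv
    exact mul_ne_zero hn' hU h_deriv.symm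
  have hTx : (Chebyshev.T ℝ n).eval x = c * (Lagrange.nodal s id).eval x := by
    conv_lhs => rw [h_fac, eval_mul, eval_C]
  have h_sub : x - i ≠ 0 := sub_ne_zero.mpr (h_ne i hi)
  rw [Lagrange.nodalWeight_eq_eval_derivative_nodal hi, hTx]
  simp only [id]
  field_simp
  linear_combination (-(f.eval i) * (Lagrange.nodal s id).eval x) * h_deriv

/-- A polynomial of degree less than `n` bounded by `M / √(1 - x²)` on `[-1, 1]` is bounded by
`M * U_{n-1}` to the right of the interval. -/
lemma abs_eval_le_mul_eval_U {n : ℕ} (hn : n ≠ 0) {f : ℝ[X]} (hf : f.degree < n) {M : ℝ}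
    (hM : ∀ x ∈ Set.Icc (-1 : ℝ) 1, Real.sqrt (1 - x ^ 2) * |f.eval x| ≤ M) {x : ℝ}
    (hx : 1 < x) :
    |f.eval x| ≤ M * (Chebyshev.U ℝ ((n : ℤ) - 1)).eval x := by
  have hUdeg : (Chebyshev.U ℝ ((n : ℤ) - 1)).degree < n := by
    obtain ⟨m, rfl⟩ := Nat.exists_eq_succ_of_ne_zero hn
    rw [show ((m.succ : ℕ) : ℤ) - 1 = m by push_cast; ring, Chebyshev.degree_U_natCast]
    exact_mod_cast m.lt_succ_self
  rw [eval_eq_sum_roots_T hn hf hx, eval_eq_sum_roots_T hn hUdeg hx, Finset.mul_sum]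
  refine (Finset.abs_sum_le_sum_abs _ _).trans (Finset.sum_le_sum fun i hi => ?_)
  have hi0 : (Chebyshev.T ℝ n).eval i = 0 := by
    simpa [Chebyshev.T_ne_zero] using hi
  obtain ⟨h_mem, h_one⟩ := sqrt_one_sub_sq_mul_abs_eval_U_of_eval_T_eq_zero hn hi0
  have hU : (Chebyshev.U ℝ ((n : ℤ) - 1)).eval i ≠ 0 := fun h => by simp [h] at h_one
  have h_nonneg : 0 ≤ (Chebyshev.T ℝ n).eval x / (n * (x - i)) :=
    div_nonneg (zero_le_one.trans (Chebyshev.one_le_eval_T_real n hx.le))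
      (mul_nonneg n.cast_nonneg (by linarith [h_mem.2]))
  rw [abs_mul, abs_of_nonneg h_nonneg, div_self hU, one_mul]
  refine mul_le_mul_of_nonneg_right ?_ h_nonneg
  rw [abs_div, div_le_iff₀ (abs_pos.mpr hU)]
  calc |f.eval i| = Real.sqrt (1 - i ^ 2) * |f.eval i| *
        |(Chebyshev.U ℝ ((n : ℤ) - 1)).eval i| := by linear_combination -|f.eval i| * h_one
    _ ≤ _ := mul_le_mul_of_nonneg_right (hM i h_mem) (abs_nonneg _)

/-- Growth of a polynomial to the right of `[-1, 1]` under a Bernstein-type bound on its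
derivative. -/
lemma mul_sub_eval_le_mul_eval_T_sub_one {n : ℕ} (hn : n ≠ 0) {P : ℝ[X]}
    (hP : (derivative P).degree < n) {M : ℝ}
    (hM : ∀ x ∈ Set.Icc (-1 : ℝ) 1, Real.sqrt (1 - x ^ 2) * |(derivative P).eval x| ≤ M)
    {a : ℝ} (ha : 1 ≤ a) :
    n * (P.eval a - P.eval 1) ≤ M * ((Chebyshev.T ℝ n).eval a - 1) := by
  set Q : ℝ[X] := C M * Chebyshev.T ℝ n - C (n : ℝ) * P with hQ
  have h_mono : MonotoneOn (fun x => Q.eval x) (Set.Ici 1) := by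
    refine monotoneOn_of_deriv_nonneg (convex_Ici 1) Q.continuous.continuousOn
      Q.differentiable.differentiableOn fun x hx => ?_
    rw [interior_Ici, Set.mem_Ioi] at hx
    have h := (le_abs_self _).trans (abs_eval_le_mul_eval_U hn hP hM hx)
    have hn' : (0 : ℝ) ≤ n := n.cast_nonneg
    rw [Polynomial.deriv, hQ]
    simp only [derivative_sub, derivative_C_mul, Chebyshev.T_derivative_eq_U, eval_sub, eval_mul,
      eval_C, Int.cast_natCast, eval_natCast]
    nlinarith [mul_le_mul_of_nonneg_left h hn']
  have h := h_mono (Set.mem_Ici.mpr le_rfl) (Set.mem_Ici.mpr ha) ha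
  simp only [hQ, eval_sub, eval_mul, eval_C, Chebyshev.T_eval_one] at h
  linarith

theorem stmt18 (n : ℕ) (hn : 4 ≤ n) (a : ℝ)
    (ha : Real.sqrt 2 * (3 * Real.sqrt n) ^ ((1 : ℝ) / n) < a)
    (p : Polynomial ℝ) (hdeg : p.natDegree = n - 1)
    (hroots : ∀ x ∈ Set.Icc (-1 : ℝ) 1, p.eval x ≠ 0) :
    n * sInf ((fun x => |((X - C a) * p).eval x|) '' Set.Icc (-1 : ℝ) 1)
        / Real.sqrt (chebT n a ^ 2 - 1)
      ≤ sSup ((fun x => Real.sqrt (1 - x ^ 2) * |(derivative ((X - C a) * p)).eval x|) ''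
          Set.Icc (-1 : ℝ) 1) := by
  have hn0 : n ≠ 0 := by omega
  have ha1 : 1 < a := by
    have h_sqrt : (1 : ℝ) ≤ Real.sqrt n := by
      rw [Real.one_le_sqrt]
      exact_mod_cast (by omega : 1 ≤ n)
    have h_pow : (1 : ℝ) ≤ (3 * Real.sqrt n) ^ ((1 : ℝ) / n) :=
      Real.one_le_rpow (by linarith) (by positivity)
    nlinarith [Real.one_lt_sqrt_two]
  have hT : 1 < (Chebyshev.T ℝ n).eval a :=
    Chebyshev.one_lt_eval_T_real (by exact_mod_cast hn0) ha1
  set P := (X - C a) * p with hP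
  set M := sSup ((fun x => Real.sqrt (1 - x ^ 2) * |(derivative P).eval x|) ''
    Set.Icc (-1 : ℝ) 1)
  have h_bdd : BddAbove ((fun x => Real.sqrt (1 - x ^ 2) * |(derivative P).eval x|) ''
      Set.Icc (-1 : ℝ) 1) :=
    (isCompact_Icc.image (by fun_prop)).bddAbove
  have hM : ∀ x ∈ Set.Icc (-1 : ℝ) 1, Real.sqrt (1 - x ^ 2) * |(derivative P).eval x| ≤ M :=
    fun x hx => le_csSup h_bdd ⟨x, hx, rfl⟩
  have hM0 : 0 ≤ M := by simpa using hM 1 (by simp)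
  have h_deg : (derivative P).degree < n := by
    have h1 : P.natDegree ≤ n := by
      refine natDegree_mul_le.trans ?_
      rw [natDegree_X_sub_C, hdeg]
      omega
    have h2 := natDegree_derivative_le P
    exact (degree_le_natDegree.trans_lt (by exact_mod_cast (by omega)))
  have h_upper := mul_sub_eval_le_mul_eval_T_sub_one hn0 h_deg hM ha1.le
  have h_lower := mul_sub_eval_le_mul_eval_T_sub_one (P := -P) hn0 (by simpa using h_deg)
    (by simpa using hM) ha1.le
  have hPa : P.eval a = 0 := by simp [hP]
  rw [eval_neg, eval_neg, hPa] at h_lower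
  rw [hPa] at h_upper
  have h_inf : sInf ((fun x => |P.eval x|) '' Set.Icc (-1 : ℝ) 1) ≤ |P.eval 1| :=
    csInf_le ⟨0, by rintro _ ⟨x, -, rfl⟩; exact abs_nonneg _⟩ ⟨1, by simp, rfl⟩
  have h_sqrt : (Chebyshev.T ℝ n).eval a - 1 ≤ Real.sqrt (chebT n a ^ 2 - 1) :=
    Real.le_sqrt_of_sq_le (by rw [chebT]; nlinarith)
  rw [div_le_iff₀ (by linarith)]
  calc n * sInf ((fun x => |P.eval x|) '' Set.Icc (-1 : ℝ) 1) ≤ n * |P.eval 1| := by gcongr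
    _ ≤ M * ((Chebyshev.T ℝ n).eval a - 1) := by
      rcases abs_cases (P.eval 1) with ⟨h, -⟩ | ⟨h, -⟩ <;> rw [h] <;> linarith
    _ ≤ M * Real.sqrt (chebT n a ^ 2 - 1) := by gcongr
end
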